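/- Let P be a type and M = P →₀ ℕ the free commutative monoid on P acting by translation on P →₀ ℤ. Let f : P → WithBot ℤ be a function such that the set {p | ¬ f p ≤ 0} is finite. Then A(f) = { x : P →₀ ℤ | ∀ p, f p ≤ (x p : WithBot ℤ) } is closed under the translation action of M and is a filtered M-set. -/

import Mathlib

/-- The canonical embedding of the free commutative monoid `P →₀ ℕ` into its
Grothendieck group `P →₀ ℤ`. -/
noncomputable def natToInt {P : Type*} (m : P →₀ ℕ) : P →₀ ℤ :=
  Finsupp.mapRange (fun n : ℕ => (n : ℤ)) (by simp) m

/-- For `f : P → WithBot ℤ`, the set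
`A(f) = { x : P →₀ ℤ | ∀ p, f p ≤ x p }`. -/
def Af {P : Type*} (f : P → WithBot ℤ) : Set (P →₀ ℤ) :=
  {x : P →₀ ℤ | ∀ p : P, f p ≤ ((x p : ℤ) : WithBot ℤ)}

/-- A subset of `P →₀ ℤ` is closed under the translation action of the free
commutative monoid `P →₀ ℕ`. -/
def IsTranslationClosed {P : Type*} (A : Set (P →₀ ℤ)) : Prop :=
  ∀ m : P →₀ ℕ, ∀ x ∈ A, natToInt m + x ∈ A

/-- A translation-closed subset `A ⊆ P →₀ ℤ` is a filtered `(P →₀ ℕ)`-set. -/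
def IsFilteredTranslationSet {P : Type*} (A : Set (P →₀ ℤ)) : Prop :=
  A.Nonempty ∧
  (∀ m₁ m₂ : P →₀ ℕ, ∀ a ∈ A, natToInt m₁ + a = natToInt m₂ + a →
    ∃ m : P →₀ ℕ, ∃ b ∈ A, natToInt m + b = a ∧ m₁ + m = m₂ + m) ∧
  (∀ a₁ ∈ A, ∀ a₂ ∈ A, ∃ m₁ m₂ : P →₀ ℕ, ∃ a ∈ A,
    natToInt m₁ + a = a₁ ∧ natToInt m₂ + a = a₂)

theorem natToInt_apply {P : Type*} (m : P →₀ ℕ) (p : P) : natToInt m p = (m p : ℤ) := rfl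

theorem natToInt_injective {P : Type*} :
    Function.Injective (natToInt : (P →₀ ℕ) → P →₀ ℤ) :=
  Finsupp.mapRange_injective _ Nat.cast_zero Nat.cast_injective

theorem exists_natToInt_add_eq {P : Type*} {a b : P →₀ ℤ} (h : a ≤ b) :
    ∃ m : P →₀ ℕ, natToInt m + a = b := by
  refine ⟨(b - a).mapRange Int.toNat rfl, Finsupp.ext fun p => ?_⟩
  have := h p
  simp only [Finsupp.add_apply, natToInt_apply, Finsupp.mapRange_apply, Finsupp.sub_apply]
  lia

theorem Af_isTranslationClosed {P : Type*} (f : P → WithBot ℤ) :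
    IsTranslationClosed (Af f) := fun m x hx p =>
  (hx p).trans <| WithBot.coe_le_coe.2 <| by simp [natToInt_apply]

theorem Af_nonempty {P : Type*} (f : P → WithBot ℤ) (hf : {p : P | ¬ f p ≤ 0}.Finite) :
    (Af f).Nonempty := by
  classical
  refine ⟨Finsupp.onFinset hf.toFinset (fun p => if f p ≤ 0 then 0 else (f p).unbotD 0)
    (fun p hp => ?_), fun p => ?_⟩
  · simp only [Set.Finite.mem_toFinset, Set.mem_ofPred_eq]
    exact fun h => hp (if_pos h)
  · rw [Finsupp.onFinset_apply]
    split_ifs with h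
    · exact h
    · exact WithBot.le_coe_unbotD _ _

theorem inf_mem_Af {P : Type*} {f : P → WithBot ℤ} {a b : P →₀ ℤ} (ha : a ∈ Af f)
    (hb : b ∈ Af f) : a ⊓ b ∈ Af f := fun p => by
  rw [Finsupp.inf_apply, WithBot.coe_inf]
  exact le_inf (ha p) (hb p)

/-- For `f : P → WithBot ℤ` taking positive values only finitely often, the set
`A(f)` is closed under the translation action of `P →₀ ℕ` and is a filtered
`(P →₀ ℕ)`-set. -/
theorem Af_filtered {P : Type*} (f : P → WithBot ℤ)
    (hf : {p : P | ¬ f p ≤ 0}.Finite) :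
    IsTranslationClosed (Af f) ∧ IsFilteredTranslationSet (Af f) := by
  refine ⟨Af_isTranslationClosed f, Af_nonempty f hf, fun m₁ m₂ a ha h => ?_,
    fun a₁ h₁ a₂ h₂ => ?_⟩
  · obtain rfl := natToInt_injective (add_right_cancel h)
    obtain ⟨m, hm⟩ := exists_natToInt_add_eq (le_refl a)
    exact ⟨m, a, ha, hm, rfl⟩
  · obtain ⟨m₁, hm₁⟩ := exists_natToInt_add_eq (inf_le_left : a₁ ⊓ a₂ ≤ a₁)
    obtain ⟨m₂, hm₂⟩ := exists_natToInt_add_eq (inf_le_right : a₁ ⊓ a₂ ≤ a₂)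
    exact ⟨m₁, m₂, a₁ ⊓ a₂, inf_mem_Af h₁ h₂, hm₁, hm₂⟩
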